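/- arXiv:math/0105195 — 12 statements merged into one kernel-verified Lean document; each statement's English description precedes it below -/
import Mathlib

section
/- Let x = ι(a) S^n S^{*m} ι(b) and y = ι(c) S^j S^{*k} ι(d) with a, b, c, d ∈ A and n, m, j, k ∈ ℕ. If m ≤ j then x·y = ι(a · α^n(ℒ^m(b·c))) S^{n-m+j} S^{*k} ι(d), and if m ≥ j then x·y = ι(a) S^n S^{*(m-j+k)} ι(α^k(ℒ^j(b·c)) · d). -/
/-- Powers of an element implementing `α` implement the iterates of `α`. -/
theorem pow_mul_eq_iterate_mul_pow {A B : Type*} [Monoid B] {α : A → A} {ι : A → B} {S : B}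
    (h : ∀ a, S * ι a = ι (α a) * S) (n : ℕ) (a : A) :
    S ^ n * ι a = ι (α^[n] a) * S ^ n := by
  induction n generalizing a with
  | zero => simp
  | succ n ih => rw [pow_succ, mul_assoc, h, ← mul_assoc, ih, mul_assoc, Function.iterate_succ_apply]

theorem mul_pow_eq_pow_mul_iterate {A B : Type*} [Monoid B] {α : A → A} {ι : A → B} {T : B}
    (h : ∀ a, ι a * T = T * ι (α a)) (n : ℕ) (a : A) :
    ι a * T ^ n = T ^ n * ι (α^[n] a) := by
  induction n generalizing a with
  | zero => simp
  | succ n ih =>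
    rw [pow_succ', ← mul_assoc, h, mul_assoc, ih, ← mul_assoc, Function.iterate_succ_apply]

/-- If compressing by `T` and `S` implements `L`, then compressing by their powers implements
the iterates of `L`. -/
theorem pow_mul_mul_pow_eq_iterate {A B : Type*} [Monoid B] {L : A → A} {ι : A → B} {S T : B}
    (h : ∀ a, T * ι a * S = ι (L a)) (n : ℕ) (a : A) :
    T ^ n * ι a * S ^ n = ι (L^[n] a) := by
  induction n generalizing a with
  | zero => simp
  | succ n ih =>
    calc T ^ (n + 1) * ι a * S ^ (n + 1) = T ^ n * (T * ι a * S) * S ^ n := by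
          simp only [pow_succ T, pow_succ' S, mul_assoc]
      _ = ι (L^[n + 1] a) := by rw [h, ih, Function.iterate_succ_apply]

/-- Lemma 2.2 of Exel's "Crossed-Products by Finite Index Endomorphisms and KMS states":
the product formula for elements of the form `ι a * S^n * S*^m * ι b`. -/
theorem product_formula {A B : Type*}
    [NormedRing A] [StarRing A] [CStarRing A] [NormedAlgebra ℂ A] [CompleteSpace A]
    [StarModule ℂ A] [PartialOrder A] [StarOrderedRing A]
    [NormedRing B] [StarRing B] [CStarRing B] [NormedAlgebra ℂ B] [CompleteSpace B]
    [StarModule ℂ B]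
    (α : A →⋆ₐ[ℂ] A) (hα : Function.Injective α)
    (E : A →ₗ[ℂ] A) (hEpos : ∀ x : A, 0 ≤ x → 0 ≤ E x)
    (hErange : ∀ x : A, ∃ y : A, α y = E x)
    (hEfix : ∀ a : A, E (α a) = α a)
    (hEbimod : ∀ a b x : A, E (α a * x * α b) = α a * E x * α b)
    (L : A →ₗ[ℂ] A) (hL : ∀ a : A, α (L a) = E a)
    (ι : A →⋆ₐ[ℂ] B) (S : B)
    (hS1 : star S * S = 1)
    (hS2 : ∀ a : A, S * ι a = ι (α a) * S)
    (hS3 : ∀ a : A, star S * ι a * S = ι (L a))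
    (a b c d : A) (n m j k : ℕ) :
    (m ≤ j →
      ι a * S ^ n * (star S) ^ m * ι b * (ι c * S ^ j * (star S) ^ k * ι d)
        = ι (a * (⇑α)^[n] ((⇑L)^[m] (b * c))) * S ^ (n + j - m) * (star S) ^ k * ι d) ∧
    (j ≤ m →
      ι a * S ^ n * (star S) ^ m * ι b * (ι c * S ^ j * (star S) ^ k * ι d)
        = ι a * S ^ n * (star S) ^ (m + k - j) * ι ((⇑α)^[k] ((⇑L)^[j] (b * c)) * d)) := by
  have hstar (x : A) : ι x * star S = star S * ι (α x) := by
    simpa [map_star] using congrArg star (hS2 (star x))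
  have hpow := pow_mul_eq_iterate_mul_pow hS2
  have hstar_pow := mul_pow_eq_pow_mul_iterate hstar
  have hcompress := pow_mul_mul_pow_eq_iterate hS3
  constructor
  · intro hmj
    obtain ⟨p, rfl⟩ := Nat.exists_eq_add_of_le hmj
    rw [show n + (m + p) - m = n + p by omega]
    calc ι a * S ^ n * star S ^ m * ι b * (ι c * S ^ (m + p) * star S ^ k * ι d)
        = ι a * (S ^ n * (star S ^ m * ι (b * c) * S ^ m)) * S ^ p * star S ^ k * ι d := by
          simp only [map_mul, pow_add, mul_assoc]
      _ = _ := by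
          rw [hcompress, hpow]
          simp only [map_mul, pow_add, mul_assoc]
  · intro hjm
    obtain ⟨p, rfl⟩ := Nat.exists_eq_add_of_le' hjm
    rw [show p + j + k - j = p + k by omega]
    calc ι a * S ^ n * star S ^ (p + j) * ι b * (ι c * S ^ j * star S ^ k * ι d)
        = ι a * S ^ n * star S ^ p * ((star S ^ j * ι (b * c) * S ^ j) * star S ^ k) * ι d := by
          simp only [map_mul, pow_add, mul_assoc]
      _ = _ := by
          rw [hcompress, hstar_pow]
          simp only [map_mul, pow_add, mul_assoc]
end

section
/- The closed linear span of the set { ι(a) S^n S^{*m} ι(b) : a, b ∈ A, n, m ∈ ℕ } is equal to the C*-subalgebra of B generated by ι(A) ∪ {S}. -/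
section ToeplitzRelations

variable {A B : Type*} [Ring A] [StarRing A] [Algebra ℂ A]
  [Ring B] [StarRing B] [Algebra ℂ B]

/-- The monomials `ι a * S ^ n * (star S) ^ m * ι b`. -/
def toeplitzMonomials (ι : A →⋆ₐ[ℂ] B) (S : B) : Set B :=
  {x : B | ∃ (a b : A) (n m : ℕ), x = ι a * S ^ n * (star S) ^ m * ι b}

theorem pow_mul_map_eq_map_iterate_mul_pow {α : A →⋆ₐ[ℂ] A} {ι : A →⋆ₐ[ℂ] B} {S : B}
    (h : ∀ a : A, S * ι a = ι (α a) * S) (n : ℕ) (a : A) :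
    S ^ n * ι a = ι (α^[n] a) * S ^ n := by
  induction n generalizing a with
  | zero => simp
  | succ n ih =>
    rw [pow_succ, mul_assoc, h, ← mul_assoc, ih, mul_assoc, Function.iterate_succ_apply]

theorem map_mul_star_pow_eq_star_pow_mul_map_iterate {α : A →⋆ₐ[ℂ] A} {ι : A →⋆ₐ[ℂ] B} {S : B}
    (h : ∀ a : A, S * ι a = ι (α a) * S) (n : ℕ) (a : A) :
    ι a * star S ^ n = star S ^ n * ι (α^[n] a) := by
  have h' (a : A) : ι a * star S = star S * ι (α a) := by
    simpa [← map_star] using congrArg star (h (star a))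
  induction n generalizing a with
  | zero => simp
  | succ n ih =>
    rw [pow_succ', ← mul_assoc, h', mul_assoc, ih, ← mul_assoc, Function.iterate_succ_apply]

theorem star_pow_mul_map_mul_pow {L : A →ₗ[ℂ] A} {ι : A →⋆ₐ[ℂ] B} {S : B}
    (h : ∀ a : A, star S * ι a * S = ι (L a)) (n : ℕ) (a : A) :
    star S ^ n * ι a * S ^ n = ι (L^[n] a) := by
  induction n generalizing a with
  | zero => simp
  | succ n ih =>
    rw [Function.iterate_succ_apply, ← ih, ← h, pow_succ, pow_succ']
    simp only [mul_assoc]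

theorem mul_mem_toeplitzMonomials {α : A →⋆ₐ[ℂ] A} {L : A →ₗ[ℂ] A} {ι : A →⋆ₐ[ℂ] B} {S : B}
    (h₁ : ∀ a : A, S * ι a = ι (α a) * S) (h₂ : ∀ a : A, star S * ι a * S = ι (L a))
    {x y : B} (hx : x ∈ toeplitzMonomials ι S) (hy : y ∈ toeplitzMonomials ι S) :
    x * y ∈ toeplitzMonomials ι S := by
  obtain ⟨a, b, n, m, rfl⟩ := hx
  obtain ⟨c, d, k, l, rfl⟩ := hy
  rcases le_total m k with hmk | hkm
  · obtain ⟨j, rfl⟩ := Nat.exists_eq_add_of_le hmk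
    refine ⟨a * α^[n] (L^[m] (b * c)), d, n + j, l, ?_⟩
    calc ι a * S ^ n * star S ^ m * ι b * (ι c * S ^ (m + j) * star S ^ l * ι d)
        = ι a * (S ^ n * (star S ^ m * ι (b * c) * S ^ m)) * S ^ j * star S ^ l * ι d := by
          simp only [map_mul, pow_add, mul_assoc]
      _ = _ := by
          rw [star_pow_mul_map_mul_pow h₂, pow_mul_map_eq_map_iterate_mul_pow h₁]
          simp only [map_mul, pow_add, mul_assoc]
  · obtain ⟨j, rfl⟩ := Nat.exists_eq_add_of_le' hkm
    refine ⟨a, α^[l] (L^[k] (b * c)) * d, n, j + l, ?_⟩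
    calc ι a * S ^ n * star S ^ (j + k) * ι b * (ι c * S ^ k * star S ^ l * ι d)
        = ι a * S ^ n * star S ^ j *
            ((star S ^ k * ι (b * c) * S ^ k) * star S ^ l) * ι d := by
          simp only [map_mul, pow_add, mul_assoc]
      _ = _ := by
          rw [star_pow_mul_map_mul_pow h₂, map_mul_star_pow_eq_star_pow_mul_map_iterate h₁]
          simp only [map_mul, pow_add, mul_assoc]

theorem star_mem_toeplitzMonomials {ι : A →⋆ₐ[ℂ] B} {S x : B}
    (hx : x ∈ toeplitzMonomials ι S) : star x ∈ toeplitzMonomials ι S := by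
  obtain ⟨a, b, n, m, rfl⟩ := hx
  exact ⟨star b, star a, m, n, by simp [map_star, mul_assoc]⟩

theorem span_toeplitzMonomials_eq_adjoin [StarModule ℂ B] {α : A →⋆ₐ[ℂ] A} {L : A →ₗ[ℂ] A}
    {ι : A →⋆ₐ[ℂ] B} {S : B}
    (h₁ : ∀ a : A, S * ι a = ι (α a) * S) (h₂ : ∀ a : A, star S * ι a * S = ι (L a)) :
    (Submodule.span ℂ (toeplitzMonomials ι S) : Set B) =
      StarAlgebra.adjoin ℂ (Set.range ⇑ι ∪ {S}) := by
  apply Set.Subset.antisymm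
  · intro x hx
    have hι (a : A) : ι a ∈ StarAlgebra.adjoin ℂ (Set.range ⇑ι ∪ {S}) :=
      StarAlgebra.subset_adjoin ℂ _ (.inl ⟨a, rfl⟩)
    have hS : S ∈ StarAlgebra.adjoin ℂ (Set.range ⇑ι ∪ {S}) :=
      StarAlgebra.subset_adjoin ℂ _ (.inr rfl)
    induction hx using Submodule.span_induction with
    | mem x hx =>
      obtain ⟨a, b, n, m, rfl⟩ := hx
      exact mul_mem (mul_mem (mul_mem (hι a) (pow_mem hS n)) (pow_mem (star_mem hS) m)) (hι b)
    | zero => exact zero_mem _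
    | add x y _ _ hx hy => exact add_mem hx hy
    | smul c x _ hx => exact SMulMemClass.smul_mem c hx
  · intro x hx
    have hone : (1 : B) ∈ toeplitzMonomials ι S := ⟨1, 1, 0, 0, by simp⟩
    induction hx using StarAlgebra.adjoin_induction with
    | mem x hx =>
      apply Submodule.subset_span
      rcases hx with ⟨a, rfl⟩ | rfl
      · exact ⟨a, 1, 0, 0, by simp⟩
      · exact ⟨1, 1, 1, 0, by simp⟩
    | algebraMap r =>
      rw [Algebra.algebraMap_eq_smul_one]
      exact Submodule.smul_mem _ _ (Submodule.subset_span hone)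
    | add x y _ _ hx hy => exact Submodule.add_mem _ hx hy
    | mul x y _ _ hx hy =>
      have hxy := Submodule.mul_mem_mul hx hy
      rw [Submodule.span_mul_span] at hxy
      refine Submodule.span_mono ?_ hxy
      rintro _ ⟨u, hu, v, hv, rfl⟩
      exact mul_mem_toeplitzMonomials h₁ h₂ hu hv
    | star x hadj hx =>
      clear hadj
      induction hx using Submodule.span_induction with
      | mem x hx => exact Submodule.subset_span (star_mem_toeplitzMonomials hx)
      | zero => simp
      | add x y _ _ hx hy => rw [star_add]; exact Submodule.add_mem _ hx hy
      | smul c x _ hx => rw [star_smul]; exact Submodule.smul_mem _ _ hx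

end ToeplitzRelations


/-- Proposition 2.3: the Toeplitz algebra, i.e. the C*-subalgebra of `B` generated by
`ι(A) ∪ {S}`, is the closed linear span of `{ι a * S^n * S*^m * ι b}`. -/
theorem toeplitz_spanning {A B : Type*}
    [NormedRing A] [StarRing A] [CStarRing A] [NormedAlgebra ℂ A] [CompleteSpace A]
    [StarModule ℂ A] [PartialOrder A] [StarOrderedRing A]
    [NormedRing B] [StarRing B] [CStarRing B] [NormedAlgebra ℂ B] [CompleteSpace B]
    [StarModule ℂ B]
    (α : A →⋆ₐ[ℂ] A) (hα : Function.Injective α)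
    (E : A →ₗ[ℂ] A) (hEpos : ∀ x : A, 0 ≤ x → 0 ≤ E x)
    (hErange : ∀ x : A, ∃ y : A, α y = E x)
    (hEfix : ∀ a : A, E (α a) = α a)
    (hEbimod : ∀ a b x : A, E (α a * x * α b) = α a * E x * α b)
    (L : A →ₗ[ℂ] A) (hL : ∀ a : A, α (L a) = E a)
    (ι : A →⋆ₐ[ℂ] B) (S : B)
    (hS1 : star S * S = 1)
    (hS2 : ∀ a : A, S * ι a = ι (α a) * S)
    (hS3 : ∀ a : A, star S * ι a * S = ι (L a)) :
    closure (Submodule.span ℂ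
        {x : B | ∃ (a b : A) (n m : ℕ), x = ι a * S ^ n * (star S) ^ m * ι b} : Set B)
      = ((StarAlgebra.adjoin ℂ (Set.range ⇑ι ∪ {S})).topologicalClosure : Set B) := by
  rw [StarSubalgebra.topologicalClosure_coe]
  exact congrArg closure (span_toeplitzMonomials_eq_adjoin hS2 hS3)
end

section
/- Suppose B is generated as a C*-algebra by ι(A) ∪ {S}, and γ is a strongly continuous action of the circle group S¹ = { z ∈ ℂ : |z| = 1 } on B by *-automorphisms such that γ_z(S) = z·S and γ_z(ι(a)) = ι(a) for all a ∈ A and z ∈ S¹. Then the fixed-point algebra { b ∈ B : γ_z(b) = b for all z } equals the closed linear span of the set { ι(a) S^n S^{*n} ι(b) : a, b ∈ A, n ∈ ℕ }. -/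
/-- The exponential sum over the `n`-th roots of unity vanishes at frequencies `0 < |k| < n`. -/
lemma IsPrimitiveRoot.sum_range_pow_zpow_eq_zero {K : Type*} [Field K] {ζ : K} {n : ℕ}
    (hζ : IsPrimitiveRoot ζ n) {k : ℤ} (hk : k ≠ 0) (hkn : k.natAbs < n) :
    ∑ j ∈ Finset.range n, (ζ ^ j) ^ k = 0 := by
  have hne : ζ ^ k ≠ 1 := fun h ↦
    hk (Int.eq_zero_of_dvd_of_natAbs_lt_natAbs ((hζ.zpow_eq_one_iff_dvd k).1 h) (by simpa using hkn))
  have hpow : ∀ j : ℕ, (ζ ^ j) ^ k = (ζ ^ k) ^ j := fun j ↦ by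
    rw [← zpow_natCast, ← zpow_natCast, zpow_comm]
  have hmul := mul_geom_sum (ζ ^ k) n
  rw [← hpow n, hζ.pow_eq_one, one_zpow, sub_self] at hmul
  simpa [hpow] using (mul_eq_zero.1 hmul).resolve_left (sub_ne_zero.2 hne)

/-- For every `n ≠ 0` the circle contains a primitive `n`-th root of unity. -/
lemma Circle.exists_isPrimitiveRoot_coe {n : ℕ} (hn : n ≠ 0) :
    ∃ ζ : Circle, IsPrimitiveRoot (ζ : ℂ) n := by
  have h := Complex.isPrimitiveRoot_exp n hn
  exact ⟨⟨_, mem_sphere_zero_iff_norm.2 (Complex.norm_eq_one_of_pow_eq_one h.pow_eq_one hn)⟩, h⟩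

section Words

variable {A B : Type*} [Ring B] [StarRing B] [Algebra ℂ B] [StarModule ℂ B]

/-- The elements `ι a * S ^ p * S* ^ q * ι b` span a subspace containing the star algebra generated
by the range of `ι` and `S`. -/
lemma StarAlgebra.adjoin_range_union_singleton_subset_span_words [Ring A] [StarRing A] [Algebra ℂ A]
    (α : A →⋆ₐ[ℂ] A) (L : A → A) (ι : A →⋆ₐ[ℂ] B) (S : B)
    (hS2 : ∀ a : A, S * ι a = ι (α a) * S)
    (hS3 : ∀ a : A, star S * ι a * S = ι (L a)) :
    (StarAlgebra.adjoin ℂ (Set.range ⇑ι ∪ {S}) : Set B) ⊆ Submodule.span ℂ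
      {x : B | ∃ (a b : A) (p q : ℕ), x = ι a * S ^ p * (star S) ^ q * ι b} := by
  set W : Set B := {x : B | ∃ (a b : A) (p q : ℕ), x = ι a * S ^ p * (star S) ^ q * ι b}
  have hstar : ∀ a : A, ι a * star S = star S * ι (α a) := fun a ↦ by
    simpa [map_star] using congrArg star (hS2 (star a))
  have hstar_pow : ∀ (q : ℕ) (a : A), ι a * star S ^ q = star S ^ q * ι ((⇑α)^[q] a) := by
    intro q
    induction q with
    | zero => simp
    | succ q ih =>
      intro a
      rw [pow_succ', ← mul_assoc, hstar, mul_assoc, ih, ← mul_assoc, Function.iterate_succ_apply]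
  have hgen : ∀ x : B, (∀ w ∈ W, x * w ∈ W) →
      ∀ m ∈ Submodule.span ℂ W, x * m ∈ Submodule.span ℂ W := by
    intro x hx m hm
    induction hm using Submodule.span_induction with
    | mem w hw => exact Submodule.subset_span (hx w hw)
    | zero => simp
    | add u v _ _ hu hv => simpa [mul_add] using add_mem hu hv
    | smul c u _ hu => simpa [mul_smul_comm] using Submodule.smul_mem _ c hu
  have hι : ∀ c : A, ∀ w ∈ W, ι c * w ∈ W := by
    rintro c _ ⟨a, b, p, q, rfl⟩
    exact ⟨c * a, b, p, q, by simp [mul_assoc]⟩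
  have hS : ∀ w ∈ W, S * w ∈ W := by
    rintro _ ⟨a, b, p, q, rfl⟩
    refine ⟨α a, b, p + 1, q, ?_⟩
    rw [pow_succ']
    simp only [← mul_assoc, hS2]
  have hSs : ∀ w ∈ W, star S * w ∈ W := by
    rintro _ ⟨a, b, p, q, rfl⟩
    cases p with
    | zero =>
      refine ⟨1, (⇑α)^[q] a * b, 0, q + 1, ?_⟩
      simp only [pow_zero, mul_one, map_one, one_mul, map_mul]
      rw [hstar_pow, pow_succ']
      simp only [mul_assoc]
    | succ p =>
      refine ⟨L a, b, p, q, ?_⟩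
      rw [pow_succ', ← hS3]
      simp only [mul_assoc]
  have hmul : ∀ x ∈ StarAlgebra.adjoin ℂ (Set.range ⇑ι ∪ {S}),
      ∀ m ∈ Submodule.span ℂ W, x * m ∈ Submodule.span ℂ W := by
    intro x hx
    replace hx : x ∈ Algebra.adjoin ℂ ((Set.range ⇑ι ∪ {S}) ∪ star (Set.range ⇑ι ∪ {S})) := hx
    induction hx using Algebra.adjoin_induction with
    | mem x hx =>
      apply hgen
      rcases hx with (⟨c, rfl⟩ | hx) | (⟨c, hc⟩ | hx)
      · exact hι c
      · rw [Set.mem_singleton_iff.1 hx]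
        exact hS
      · rw [← star_star x, ← hc, ← map_star]
        exact hι _
      · rw [← star_star x, Set.mem_singleton_iff.1 hx]
        exact hSs
    | algebraMap r =>
      intro m hm
      simpa [← Algebra.smul_def] using Submodule.smul_mem _ r hm
    | add x y _ _ hx hy => exact fun m hm ↦ by simpa [add_mul] using add_mem (hx m hm) (hy m hm)
    | mul x y _ _ hx hy => exact fun m hm ↦ by simpa [mul_assoc] using hx _ (hy m hm)
  intro x hx
  have hone : (1 : B) ∈ Submodule.span ℂ W := Submodule.subset_span ⟨1, 1, 0, 0, by simp⟩
  simpa using hmul x hx 1 hone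

/-- The circle acts on `ι a * S ^ p * S* ^ q * ι b` by the character `z ↦ z ^ (p - q)`. -/
lemma gauge_apply_word (ι : A → B) (S : B) (γ : Circle → B ≃⋆ₐ[ℂ] B)
    (hγS : ∀ z : Circle, γ z S = (z : ℂ) • S) (hγA : ∀ (z : Circle) (a : A), γ z (ι a) = ι a)
    (z : Circle) (a b : A) (p q : ℕ) :
    γ z (ι a * S ^ p * (star S) ^ q * ι b)
      = (z : ℂ) ^ ((p : ℤ) - q) • (ι a * S ^ p * (star S) ^ q * ι b) := by
  have hz : star (z : ℂ) = (z : ℂ)⁻¹ := (Circle.coe_inv_eq_conj z).symm.trans (Circle.coe_inv z)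
  rw [map_mul, map_mul, map_mul, map_pow, map_pow, map_star, hγA, hγA, hγS, star_smul, hz,
    smul_pow, smul_pow, zpow_sub₀ (Circle.coe_ne_zero z), zpow_natCast, zpow_natCast]
  simp only [mul_smul_comm, smul_mul_assoc, smul_smul, inv_pow, div_eq_mul_inv]
  rw [mul_comm]

/-- Averaging an element of the span of the words over sufficiently fine roots of unity lands in the
span of the words of degree zero. -/
lemma exists_forall_average_mem_span (ι : A → B) (S : B)
    (γ : Circle → B ≃⋆ₐ[ℂ] B)
    (hγS : ∀ z : Circle, γ z S = (z : ℂ) • S) (hγA : ∀ (z : Circle) (a : A), γ z (ι a) = ι a)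
    {m : B} (hm : m ∈ Submodule.span ℂ
      {x : B | ∃ (a b : A) (p q : ℕ), x = ι a * S ^ p * (star S) ^ q * ι b}) :
    ∃ N : ℕ, ∀ n > N, ∀ ζ : Circle, IsPrimitiveRoot (ζ : ℂ) n →
      ∑ j ∈ Finset.range n, γ (ζ ^ j) m ∈ Submodule.span ℂ
        {x : B | ∃ (a b : A) (p : ℕ), x = ι a * S ^ p * (star S) ^ p * ι b} := by
  induction hm using Submodule.span_induction with
  | mem w hw =>
    obtain ⟨a, b, p, q, rfl⟩ := hw
    refine ⟨((p : ℤ) - q).natAbs, fun n hn ζ hζ ↦ ?_⟩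
    simp only [gauge_apply_word ι S γ hγS hγA, Circle.coe_pow]
    rw [← Finset.sum_smul]
    by_cases hpq : p = q
    · subst hpq
      exact Submodule.smul_mem _ _ (Submodule.subset_span ⟨a, b, p, rfl⟩)
    · rw [hζ.sum_range_pow_zpow_eq_zero (sub_ne_zero.2 (by exact_mod_cast hpq)) hn, zero_smul]
      exact zero_mem _
  | zero => exact ⟨0, fun n _ ζ _ ↦ by simp⟩
  | add u v _ _ hu hv =>
    obtain ⟨M, hM⟩ := hu
    obtain ⟨N, hN⟩ := hv
    refine ⟨max M N, fun n hn ζ hζ ↦ ?_⟩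
    simp only [map_add, Finset.sum_add_distrib]
    exact add_mem (hM n (lt_of_le_of_lt (le_max_left _ _) hn) ζ hζ)
      (hN n (lt_of_le_of_lt (le_max_right _ _) hn) ζ hζ)
  | smul c u _ hu =>
    obtain ⟨N, hN⟩ := hu
    refine ⟨N, fun n hn ζ hζ ↦ ?_⟩
    simp only [map_smul, ← Finset.smul_sum]
    exact Submodule.smul_mem _ c (hN n hn ζ hζ)

end Words


/-- Corollary 3.5: the fixed-point algebra of the scalar gauge action is the closed linear
span of the elements `ι a * S^n * S*^n * ι b`. -/
theorem fixed_point_algebra_of_gauge_action {A B : Type*}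
    [NormedRing A] [StarRing A] [CStarRing A] [NormedAlgebra ℂ A] [CompleteSpace A]
    [StarModule ℂ A] [PartialOrder A] [StarOrderedRing A]
    [NormedRing B] [StarRing B] [CStarRing B] [NormedAlgebra ℂ B] [CompleteSpace B]
    [StarModule ℂ B]
    (α : A →⋆ₐ[ℂ] A) (hα : Function.Injective α)
    (E : A →ₗ[ℂ] A) (hEpos : ∀ x : A, 0 ≤ x → 0 ≤ E x)
    (hErange : ∀ x : A, ∃ y : A, α y = E x)
    (hEfix : ∀ a : A, E (α a) = α a)
    (hEbimod : ∀ a b x : A, E (α a * x * α b) = α a * E x * α b)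
    (L : A →ₗ[ℂ] A) (hL : ∀ a : A, α (L a) = E a)
    (ι : A →⋆ₐ[ℂ] B) (S : B)
    (hS1 : star S * S = 1)
    (hS2 : ∀ a : A, S * ι a = ι (α a) * S)
    (hS3 : ∀ a : A, star S * ι a * S = ι (L a))
    (hgen : (StarAlgebra.adjoin ℂ (Set.range ⇑ι ∪ {S})).topologicalClosure = ⊤)
    (γ : Circle → B ≃⋆ₐ[ℂ] B)
    (hmul : ∀ (z w : Circle) (b : B), γ (z * w) b = γ z (γ w b))
    (hcont : ∀ b : B, Continuous fun z : Circle => γ z b)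
    (hγS : ∀ z : Circle, γ z S = (z : ℂ) • S)
    (hγA : ∀ (z : Circle) (a : A), γ z (ι a) = ι a) :
    {b : B | ∀ z : Circle, γ z b = b}
      = closure (Submodule.span ℂ
          {x : B | ∃ (a b : A) (p : ℕ), x = ι a * S ^ p * (star S) ^ p * ι b} : Set B) := by
  let _ : CStarAlgebra B := { }
  apply Set.Subset.antisymm
  · intro b hb
    have hbcl : b ∈ closure (StarAlgebra.adjoin ℂ (Set.range ⇑ι ∪ {S}) : Set B) := by
      rw [← StarSubalgebra.topologicalClosure_coe, hgen]
      exact StarSubalgebra.mem_top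
    rw [Metric.mem_closure_iff] at hbcl ⊢
    intro ε hε
    obtain ⟨m, hm, hbm⟩ := hbcl ε hε
    obtain ⟨N, hN⟩ := exists_forall_average_mem_span (ι := ι) S γ hγS hγA
      (StarAlgebra.adjoin_range_union_singleton_subset_span_words α L ι S hS2 hS3 hm)
    obtain ⟨ζ, hζ⟩ := Circle.exists_isPrimitiveRoot_coe N.succ_ne_zero
    have hn : ((N.succ : ℕ) : ℂ) ≠ 0 := Nat.cast_ne_zero.2 N.succ_ne_zero
    refine ⟨((N.succ : ℕ) : ℂ)⁻¹ • ∑ j ∈ Finset.range N.succ, γ (ζ ^ j) m,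
      Submodule.smul_mem _ _ (hN _ N.lt_succ_self ζ hζ), lt_of_le_of_lt ?_ hbm⟩
    have hsub : b - ((N.succ : ℕ) : ℂ)⁻¹ • ∑ j ∈ Finset.range N.succ, γ (ζ ^ j) m
        = ((N.succ : ℕ) : ℂ)⁻¹ • ∑ j ∈ Finset.range N.succ, γ (ζ ^ j) (b - m) := by
      simp only [map_sub, hb _, Finset.sum_sub_distrib, Finset.sum_const, Finset.card_range,
        smul_sub]
      rw [← Nat.cast_smul_eq_nsmul ℂ, inv_smul_smul₀ hn]
    rw [dist_eq_norm, dist_eq_norm, hsub, norm_smul, norm_inv, Complex.norm_natCast,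
      inv_mul_le_iff₀ (by positivity)]
    refine (norm_sum_le _ _).trans (le_of_eq ?_)
    simp only [StarAlgEquiv.norm_map, Finset.sum_const, Finset.card_range, nsmul_eq_mul]
  · refine closure_minimal (fun x hx ↦ ?_) ?_
    · intro z
      induction hx using Submodule.span_induction with
      | mem w hw =>
        obtain ⟨a, b, p, rfl⟩ := hw
        rw [gauge_apply_word ι S γ hγS hγA, sub_self, zpow_zero, one_smul]
      | zero => simp
      | add u v _ _ hu hv => rw [map_add, hu, hv]
      | smul c u _ hu => rw [map_smul, hu]
    · rw [Set.ofPred_forall]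
      exact isClosed_iInter fun z ↦
        isClosed_eq (StarAlgEquiv.isometry (γ z)).continuous continuous_id
end

section
/- For every n ∈ ℕ the map ℰ_n is a conditional expectation onto the range of α^n: ℰ_n is positive, ℰ_n ∘ ℰ_n = ℰ_n, ℰ_n(x) lies in the range of α^n for all x ∈ A, ℰ_n(α^n(a)) = α^n(a), and ℰ_n(α^n(a) x α^n(b)) = α^n(a) ℰ_n(x) α^n(b) for all a, b, x ∈ A. Moreover ℰ_{n+1} ∘ ℰ_n = ℰ_n ∘ ℰ_{n+1} = ℰ_{n+1}. -/
/-- An injective `*`-homomorphism of C⋆-algebras reflects positivity. -/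
theorem StarAlgHom.nonneg_of_map_nonneg {A B : Type*} [CStarAlgebra A] [PartialOrder A]
    [StarOrderedRing A] [CStarAlgebra B] [PartialOrder B] [StarOrderedRing B]
    (φ : A →⋆ₐ[ℂ] B) (hφ : Function.Injective φ) {a : A} (h : 0 ≤ φ a) : 0 ≤ a := by
  have ha : IsSelfAdjoint a := hφ <| by rw [map_star, (IsSelfAdjoint.of_nonneg h).star_eq]
  have hneg : (φ a)⁻ = φ a⁻ :=
    (CFC.posPart_negPart_unique (a := φ a) (b := φ a⁺) (c := φ a⁻)
      (by rw [← map_sub, CFC.posPart_sub_negPart a ha])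
      (by rw [← map_mul, CFC.posPart_mul_negPart, map_zero])
      (map_nonneg φ (CFC.posPart_nonneg a)) (map_nonneg φ (CFC.negPart_nonneg a))).2
  rw [(CFC.negPart_eq_zero_iff (φ a) (IsSelfAdjoint.of_nonneg h)).2 h] at hneg
  exact (CFC.negPart_eq_zero_iff a ha).1 (hφ (hneg.symm.trans (map_zero φ).symm))

/-- Section 4: each `ℰ n` is a conditional expectation onto the range of `α^n`, and
`ℰ (n+1) ∘ ℰ n = ℰ n ∘ ℰ (n+1) = ℰ (n+1)` (Proposition 4.1). -/
theorem iterated_conditional_expectations {A : Type*}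
    [NormedRing A] [StarRing A] [CStarRing A] [NormedAlgebra ℂ A] [CompleteSpace A]
    [StarModule ℂ A] [PartialOrder A] [StarOrderedRing A]
    (α : A →⋆ₐ[ℂ] A) (hα : Function.Injective α)
    (E : A →ₗ[ℂ] A) (hEpos : ∀ x : A, 0 ≤ x → 0 ≤ E x)
    (hErange : ∀ x : A, ∃ y : A, α y = E x)
    (hEfix : ∀ a : A, E (α a) = α a)
    (hEbimod : ∀ a b x : A, E (α a * x * α b) = α a * E x * α b)
    (L : A →ₗ[ℂ] A) (hL : ∀ a : A, α (L a) = E a)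
    (𝓔 : ℕ → A → A) (h𝓔0 : 𝓔 0 = id)
    (h𝓔rec : ∀ (k : ℕ) (x : A), 𝓔 (k + 1) x = α (𝓔 k (L x)))
    (n : ℕ) :
    (∀ x : A, 0 ≤ x → 0 ≤ 𝓔 n x) ∧
    (∀ x : A, 𝓔 n (𝓔 n x) = 𝓔 n x) ∧
    (∀ x : A, ∃ y : A, (⇑α)^[n] y = 𝓔 n x) ∧
    (∀ a : A, 𝓔 n ((⇑α)^[n] a) = (⇑α)^[n] a) ∧
    (∀ a b x : A, 𝓔 n ((⇑α)^[n] a * x * (⇑α)^[n] b) = (⇑α)^[n] a * 𝓔 n x * (⇑α)^[n] b) ∧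
    (∀ x : A, 𝓔 (n + 1) (𝓔 n x) = 𝓔 (n + 1) x) ∧
    (∀ x : A, 𝓔 n (𝓔 (n + 1) x) = 𝓔 (n + 1) x) := by
  let _ : CStarAlgebra A := {}
  have hLpos (x : A) (hx : 0 ≤ x) : 0 ≤ L x :=
    α.nonneg_of_map_nonneg hα (by rw [hL]; exact hEpos x hx)
  have hLα (a : A) : L (α a) = a := hα (by rw [hL, hEfix])
  have hLbimod (a b x : A) : L (α a * x * α b) = a * L x * b :=
    hα (by simp only [hL, hEbimod, map_mul])
  induction n with
  | zero => simp [h𝓔0]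
  | succ n ih =>
    obtain ⟨hpos, hidem, hrange, hfix, hbimod, hleft, hright⟩ := ih
    refine ⟨fun x hx => ?_, fun x => ?_, fun x => ?_, fun a => ?_, fun a b x => ?_,
      fun x => ?_, fun x => ?_⟩
    · rw [h𝓔rec]
      exact map_nonneg α (hpos _ (hLpos x hx))
    · rw [h𝓔rec n x, h𝓔rec, hLα, hidem]
    · obtain ⟨y, hy⟩ := hrange (L x)
      exact ⟨y, by rw [Function.iterate_succ_apply', hy, h𝓔rec]⟩
    · rw [Function.iterate_succ_apply', h𝓔rec, hLα, hfix]
    · simp only [Function.iterate_succ_apply', h𝓔rec, hLbimod, hbimod, map_mul]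
    · rw [h𝓔rec n x, h𝓔rec (n + 1), hLα, hleft, ← h𝓔rec]
    · rw [h𝓔rec (n + 1) x, h𝓔rec n, hLα, hright]
end

section
/- With e_n := S^n S^{*n}, for every n ∈ ℕ and every a ∈ A one has e_n ι(a) e_n = ι(ℰ_n(a)) e_n = e_n ι(ℰ_n(a)). -/
/-- If `S` implements `α` on the left and compression by `S` implements `L`, then iterated
compression followed by `S ^ n` is left multiplication by `𝓔 n a = α^n (L^n a)`. -/
theorem pow_mul_compression {A B : Type*} [Monoid B] {α L : A → A} {𝓔 : ℕ → A → A} {ι : A → B}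
    {S T : B} (h𝓔0 : 𝓔 0 = id) (h𝓔rec : ∀ k x, 𝓔 (k + 1) x = α (𝓔 k (L x)))
    (hS : ∀ a, S * ι a = ι (α a) * S) (hL : ∀ a, T * ι a * S = ι (L a)) (n : ℕ) (a : A) :
    S ^ n * (T ^ n * ι a * S ^ n) = ι (𝓔 n a) * S ^ n := by
  induction n generalizing a with
  | zero => simp [h𝓔0]
  | succ n ih =>
    calc S ^ (n + 1) * (T ^ (n + 1) * ι a * S ^ (n + 1))
        = S * (S ^ n * (T ^ n * (T * ι a * S) * S ^ n)) := by
          rw [pow_succ' S, pow_succ T]; simp only [mul_assoc]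
      _ = S * ι (𝓔 n (L a)) * S ^ n := by rw [hL, ih, mul_assoc]
      _ = ι (𝓔 (n + 1) a) * S ^ (n + 1) := by rw [hS, h𝓔rec, mul_assoc, pow_succ']

/-- The mirror image of `pow_mul_compression`, where `T` implements `α` on the right. -/
theorem compression_mul_pow {A B : Type*} [Monoid B] {α L : A → A} {𝓔 : ℕ → A → A} {ι : A → B}
    {S T : B} (h𝓔0 : 𝓔 0 = id) (h𝓔rec : ∀ k x, 𝓔 (k + 1) x = α (𝓔 k (L x)))
    (hT : ∀ a, ι a * T = T * ι (α a)) (hL : ∀ a, T * ι a * S = ι (L a)) (n : ℕ) (a : A) :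
    T ^ n * ι a * S ^ n * T ^ n = T ^ n * ι (𝓔 n a) := by
  induction n generalizing a with
  | zero => simp [h𝓔0]
  | succ n ih =>
    calc T ^ (n + 1) * ι a * S ^ (n + 1) * T ^ (n + 1)
        = T ^ n * (T * ι a * S) * S ^ n * T ^ n * T := by
          rw [pow_succ' S, pow_succ T]; simp only [mul_assoc]
      _ = T ^ n * (ι (𝓔 n (L a)) * T) := by rw [hL, ih, mul_assoc]
      _ = T ^ (n + 1) * ι (𝓔 (n + 1) a) := by rw [hT, h𝓔rec, ← mul_assoc, pow_succ]


/-- Proposition 5.1.(iii): with `e n = S^n S*^n`, one has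
`e n * ι a * e n = ι (ℰ n a) * e n = e n * ι (ℰ n a)`. -/
theorem projection_compression {A B : Type*}
    [NormedRing A] [StarRing A] [CStarRing A] [NormedAlgebra ℂ A] [CompleteSpace A]
    [StarModule ℂ A] [PartialOrder A] [StarOrderedRing A]
    [NormedRing B] [StarRing B] [CStarRing B] [NormedAlgebra ℂ B] [CompleteSpace B]
    [StarModule ℂ B]
    (α : A →⋆ₐ[ℂ] A) (hα : Function.Injective α)
    (E : A →ₗ[ℂ] A) (hEpos : ∀ x : A, 0 ≤ x → 0 ≤ E x)
    (hErange : ∀ x : A, ∃ y : A, α y = E x)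
    (hEfix : ∀ a : A, E (α a) = α a)
    (hEbimod : ∀ a b x : A, E (α a * x * α b) = α a * E x * α b)
    (L : A →ₗ[ℂ] A) (hL : ∀ a : A, α (L a) = E a)
    (𝓔 : ℕ → A → A) (h𝓔0 : 𝓔 0 = id)
    (h𝓔rec : ∀ (k : ℕ) (x : A), 𝓔 (k + 1) x = α (𝓔 k (L x)))
    (ι : A →⋆ₐ[ℂ] B) (S : B)
    (hS1 : star S * S = 1)
    (hS2 : ∀ a : A, S * ι a = ι (α a) * S)
    (hS3 : ∀ a : A, star S * ι a * S = ι (L a))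
    (n : ℕ) (a : A) :
    S ^ n * (star S) ^ n * ι a * (S ^ n * (star S) ^ n)
        = ι (𝓔 n a) * (S ^ n * (star S) ^ n) ∧
    ι (𝓔 n a) * (S ^ n * (star S) ^ n) = S ^ n * (star S) ^ n * ι (𝓔 n a) := by
  have hT (a : A) : ι a * star S = star S * ι (α a) := by
    simpa [map_star] using congrArg star (hS2 (star a))
  have hleft : S ^ n * star S ^ n * ι a * (S ^ n * star S ^ n)
      = ι (𝓔 n a) * (S ^ n * star S ^ n) := by
    simpa only [mul_assoc] using
      congrArg (· * star S ^ n) (pow_mul_compression h𝓔0 h𝓔rec hS2 hS3 n a)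
  have hright : S ^ n * star S ^ n * ι a * (S ^ n * star S ^ n)
      = S ^ n * star S ^ n * ι (𝓔 n a) := by
    simpa only [mul_assoc] using
      congrArg (S ^ n * ·) (compression_mul_pow h𝓔0 h𝓔rec hT hS3 n a)
  exact ⟨hleft, hleft.symm.trans hright⟩
end

section
/- With e_n := S^n S^{*n}, for all n, m ∈ ℕ with n ≤ m one has e_m ≤ e_n (i.e. e_n e_m = e_m = e_m e_n), and for all a, b, c, d ∈ A the product formula (ι(a) e_n ι(b)) · (ι(c) e_m ι(d)) = ι(a ℰ_n(b c)) e_m ι(d) holds. -/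
/-- The range projection of `S ^ n`, compressed against `ι x * S ^ n`, acts through the maps `𝓔 n`. -/
theorem pow_mul_pow_mul_map_mul_pow {A B : Type*} [Monoid B] {α L : A → A} {𝓔 : ℕ → A → A}
    (h𝓔0 : 𝓔 0 = id) (h𝓔rec : ∀ (k : ℕ) (x : A), 𝓔 (k + 1) x = α (𝓔 k (L x)))
    {ι : A → B} {S T : B} (hS : ∀ a, S * ι a = ι (α a) * S) (hT : ∀ a, T * ι a * S = ι (L a))
    (n : ℕ) (x : A) : S ^ n * T ^ n * (ι x * S ^ n) = ι (𝓔 n x) * S ^ n := by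
  induction n generalizing x with
  | zero => simp [h𝓔0]
  | succ n ih =>
    calc S ^ (n + 1) * T ^ (n + 1) * (ι x * S ^ (n + 1))
        = S * (S ^ n * T ^ n * (T * ι x * S * S ^ n)) := by
          rw [pow_succ' S, pow_succ T]; simp only [mul_assoc]
      _ = ι (𝓔 (n + 1) x) * S ^ (n + 1) := by
          rw [hT, ih, ← mul_assoc, hS, h𝓔rec, pow_succ' S, mul_assoc]

/-- Propositions 5.1.(i) and 4.9: with `e n = S^n S*^n`, for `n ≤ m` one has `e m ≤ e n`
(expressed as `e n * e m = e m = e m * e n`) and the product formula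
`(ι a * e n * ι b) * (ι c * e m * ι d) = ι (a * ℰ n (b c)) * e m * ι d`. -/
theorem projection_order_and_product {A B : Type*}
    [NormedRing A] [StarRing A] [CStarRing A] [NormedAlgebra ℂ A] [CompleteSpace A]
    [StarModule ℂ A] [PartialOrder A] [StarOrderedRing A]
    [NormedRing B] [StarRing B] [CStarRing B] [NormedAlgebra ℂ B] [CompleteSpace B]
    [StarModule ℂ B]
    (α : A →⋆ₐ[ℂ] A) (hα : Function.Injective α)
    (E : A →ₗ[ℂ] A) (hEpos : ∀ x : A, 0 ≤ x → 0 ≤ E x)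
    (hErange : ∀ x : A, ∃ y : A, α y = E x)
    (hEfix : ∀ a : A, E (α a) = α a)
    (hEbimod : ∀ a b x : A, E (α a * x * α b) = α a * E x * α b)
    (L : A →ₗ[ℂ] A) (hL : ∀ a : A, α (L a) = E a)
    (𝓔 : ℕ → A → A) (h𝓔0 : 𝓔 0 = id)
    (h𝓔rec : ∀ (k : ℕ) (x : A), 𝓔 (k + 1) x = α (𝓔 k (L x)))
    (ι : A →⋆ₐ[ℂ] B) (S : B)
    (hS1 : star S * S = 1)
    (hS2 : ∀ a : A, S * ι a = ι (α a) * S)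
    (hS3 : ∀ a : A, star S * ι a * S = ι (L a))
    (n m : ℕ) (hnm : n ≤ m) :
    (S ^ n * (star S) ^ n * (S ^ m * (star S) ^ m) = S ^ m * (star S) ^ m) ∧
    (S ^ m * (star S) ^ m * (S ^ n * (star S) ^ n) = S ^ m * (star S) ^ m) ∧
    (∀ a b c d : A,
      ι a * (S ^ n * (star S) ^ n) * ι b * (ι c * (S ^ m * (star S) ^ m) * ι d)
        = ι (a * 𝓔 n (b * c)) * (S ^ m * (star S) ^ m) * ι d) := by
  obtain ⟨k, rfl⟩ := Nat.exists_eq_add_of_le hnm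
  have hpow : star S ^ n * S ^ n = 1 := pow_mul_pow_eq_one n hS1
  refine ⟨?_, ?_, fun a b c d => ?_⟩
  · calc _ = S ^ n * (star S ^ n * S ^ n) * (S ^ k * star S ^ (n + k)) := by
          rw [pow_add S]; simp only [mul_assoc]
      _ = _ := by rw [hpow, pow_add S]; simp only [mul_assoc, mul_one]
  · calc _ = S ^ (n + k) * star S ^ k * (star S ^ n * S ^ n) * star S ^ n := by
          rw [add_comm n k, pow_add (star S)]; simp only [mul_assoc]
      _ = _ := by rw [hpow, add_comm n k, pow_add (star S)]; simp only [mul_assoc, mul_one]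
  · calc _ = ι a * (S ^ n * star S ^ n * (ι (b * c) * S ^ n)) *
            (S ^ k * star S ^ (n + k) * ι d) := by
          rw [pow_add S, map_mul]; simp only [mul_assoc]
      _ = _ := by
          rw [pow_mul_pow_mul_map_mul_pow h𝓔0 h𝓔rec hS2 hS3, pow_add S, map_mul]
          simp only [mul_assoc]
end

section
/- With e_n := S^n S^{*n}, for every n ∈ ℕ and all a, b ∈ A one has S* (ι(a) e_{n+1} ι(b)) S = ι(ℒ(a)) e_n ι(ℒ(b)) and S · ι(a) e_n ι(b) = ι(α(a)) e_{n+1} ι(α(b)) · S. Consequently, writing K_n for the closed linear span of { ι(a) e_n ι(b) : a, b ∈ A }, one has S* K_{n+1} S ⊆ K_n and S K_n ⊆ K_{n+1} S. -/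
/-- If `x ↦ c * x * d` maps `s` into `t`, it maps the closed linear span of `s` into that of `t`. -/
theorem mul_mul_mem_closure_span {𝕜 B : Type*} [CommSemiring 𝕜] [Semiring B] [Algebra 𝕜 B]
    [TopologicalSpace B] [ContinuousMul B] {s t : Set B} (c d : B)
    (h : ∀ x ∈ s, c * x * d ∈ t) {x : B} (hx : x ∈ closure (Submodule.span 𝕜 s : Set B)) :
    c * x * d ∈ closure (Submodule.span 𝕜 t : Set B) := by
  refine map_mem_closure (f := fun x => c * x * d) (by fun_prop) hx fun y hy => ?_
  have hle : Submodule.span 𝕜 s ≤ (Submodule.span 𝕜 t).comap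
      (LinearMap.mulRight 𝕜 d ∘ₗ LinearMap.mulLeft 𝕜 c) :=
    Submodule.span_le.2 fun z hz => Submodule.subset_span (h z hz)
  exact hle hy

/-- Proposition 5.1.(iv)-(v): with `e p = S^p S*^p` and `K p` the closed linear span of
`{ι a * e p * ι b}`, one has `S* (ι a * e (n+1) * ι b) S = ι (ℒ a) * e n * ι (ℒ b)`,
`S * ι a * e n * ι b = ι (α a) * e (n+1) * ι (α b) * S`, hence `S* K (n+1) S ⊆ K n` and
`S K n ⊆ K (n+1) S`. -/
theorem compression_of_ideals {A B : Type*}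
    [NormedRing A] [StarRing A] [CStarRing A] [NormedAlgebra ℂ A] [CompleteSpace A]
    [StarModule ℂ A] [PartialOrder A] [StarOrderedRing A]
    [NormedRing B] [StarRing B] [CStarRing B] [NormedAlgebra ℂ B] [CompleteSpace B]
    [StarModule ℂ B]
    (α : A →⋆ₐ[ℂ] A) (hα : Function.Injective α)
    (E : A →ₗ[ℂ] A) (hEpos : ∀ x : A, 0 ≤ x → 0 ≤ E x)
    (hErange : ∀ x : A, ∃ y : A, α y = E x)
    (hEfix : ∀ a : A, E (α a) = α a)
    (hEbimod : ∀ a b x : A, E (α a * x * α b) = α a * E x * α b)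
    (L : A →ₗ[ℂ] A) (hL : ∀ a : A, α (L a) = E a)
    (ι : A →⋆ₐ[ℂ] B) (S : B)
    (hS1 : star S * S = 1)
    (hS2 : ∀ a : A, S * ι a = ι (α a) * S)
    (hS3 : ∀ a : A, star S * ι a * S = ι (L a))
    (K : ℕ → Set B)
    (hK : ∀ p : ℕ, K p = closure (Submodule.span ℂ
        {x : B | ∃ a b : A, x = ι a * (S ^ p * (star S) ^ p) * ι b} : Set B))
    (n : ℕ) :
    (∀ a b : A, star S * (ι a * (S ^ (n + 1) * (star S) ^ (n + 1)) * ι b) * S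
        = ι (L a) * (S ^ n * (star S) ^ n) * ι (L b)) ∧
    (∀ a b : A, S * (ι a * (S ^ n * (star S) ^ n) * ι b)
        = ι (α a) * (S ^ (n + 1) * (star S) ^ (n + 1)) * ι (α b) * S) ∧
    (∀ x ∈ K (n + 1), star S * x * S ∈ K n) ∧
    (∀ x ∈ K n, ∃ y ∈ K (n + 1), S * x = y * S) := by
  have hstar : ∀ b : A, ι b * star S = star S * ι (α b) := fun b => by
    have h := congrArg star (hS2 (star b))
    rwa [star_mul, star_mul, ← map_star ι, ← map_star ι, ← map_star α, star_star] at h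
  have hcompress : ∀ a b : A,
      star S * (ι a * (S ^ (n + 1) * (star S) ^ (n + 1)) * ι b) * S
        = ι (L a) * (S ^ n * (star S) ^ n) * ι (L b) := fun a b => by
    rw [← hS3 a, ← hS3 b, pow_succ' S, pow_succ (star S)]
    simp only [mul_assoc]
  have hconj : ∀ a b : A, S * (ι a * (S ^ n * (star S) ^ n) * ι b) * star S
      = ι (α a) * (S ^ (n + 1) * (star S) ^ (n + 1)) * ι (α b) := fun a b => by
    calc S * (ι a * (S ^ n * (star S) ^ n) * ι b) * star S
        = (S * ι a) * (S ^ n * (star S) ^ n) * (ι b * star S) := by simp only [mul_assoc]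
      _ = ι (α a) * (S ^ (n + 1) * (star S) ^ (n + 1)) * ι (α b) := by
        rw [hS2, hstar, pow_succ' S, pow_succ (star S)]
        simp only [mul_assoc]
  have hcancel : ∀ x : B, S * x = S * x * star S * S := fun x => by
    rw [mul_assoc _ (star S), hS1, mul_one]
  refine ⟨hcompress, fun a b => ?_, fun x hx => ?_, fun x hx => ⟨S * x * star S, ?_, hcancel x⟩⟩
  · rw [← hconj, ← hcancel]
  · rw [hK] at hx ⊢
    refine mul_mul_mem_closure_span _ _ ?_ hx
    rintro _ ⟨a, b, rfl⟩
    exact ⟨L a, L b, hcompress a b⟩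
  · rw [hK] at hx ⊢
    refine mul_mul_mem_closure_span _ _ ?_ hx
    rintro _ ⟨a, b, rfl⟩
    exact ⟨α a, α b, hconj a b⟩
end

section
/- Let B and J be closed *-subalgebras of a C*-algebra C such that J equals the closed linear span of the set of products { j·b : j ∈ J, b ∈ B }. If x ∈ J and x·b ∈ B for every b ∈ B, then x ∈ B. -/
open Filter Topology in
/-- For a bounded family `e` in a normed ring, the elements `y` with `y * e i → y` form a
closed set. -/
theorem tendsto_mul_of_mem_closure {R ι : Type*} [NormedRing R] {l : Filter ι} {e : ι → R}
    (he : ∀ᶠ i in l, ‖e i‖ ≤ 1) {s : Set R} (hs : ∀ y ∈ s, Tendsto (fun i => y * e i) l (𝓝 y))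
    {y : R} (hy : y ∈ closure s) : Tendsto (fun i => y * e i) l (𝓝 y) := by
  rw [Metric.tendsto_nhds]
  intro ε hε
  obtain ⟨z, hz, hyz⟩ := Metric.mem_closure_iff.mp hy (ε / 3) (by positivity)
  filter_upwards [he, Metric.tendsto_nhds.mp (hs z hz) (ε / 3) (by positivity)] with i hi hzi
  have hmul : dist (y * e i) (z * e i) ≤ dist y z := by
    rw [dist_eq_norm, dist_eq_norm, ← sub_mul]
    exact (norm_mul_le _ _).trans (mul_le_of_le_one_right (norm_nonneg _) hi)
  have htri := dist_triangle4 (y * e i) (z * e i) z y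
  rw [dist_comm z y] at htri
  linarith

open Filter Topology in
/-- The elements `y` with `y * e i → y` form a linear subspace. -/
theorem tendsto_mul_of_mem_span {𝕜 R ι : Type*} [NormedField 𝕜] [NormedRing R] [NormedAlgebra 𝕜 R]
    {l : Filter ι} {e : ι → R} {s : Set R} (hs : ∀ y ∈ s, Tendsto (fun i => y * e i) l (𝓝 y))
    {y : R} (hy : y ∈ Submodule.span 𝕜 s) : Tendsto (fun i => y * e i) l (𝓝 y) := by
  induction hy using Submodule.span_induction with
  | mem y hy => exact hs y hy
  | zero => simpa only [zero_mul] using tendsto_const_nhds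
  | add y z _ _ hy hz => simpa only [add_mul] using hy.add hz
  | smul c y _ hy => simpa only [smul_mul_assoc] using hy.const_smul c

open Filter in
/-- Every C*-algebra has an increasing approximate unit; this version forgets the order. -/
theorem exists_isApproximateUnit_norm_le_one (A : Type*) [NonUnitalCStarAlgebra A] :
    ∃ l : Filter A, l.IsApproximateUnit ∧ ∀ᶠ x in l, ‖x‖ ≤ 1 := by
  let _ := CStarAlgebra.spectralOrder A
  have := CStarAlgebra.spectralOrderedRing A
  have h := CStarAlgebra.increasingApproximateUnit A
  exact ⟨_, h.toIsApproximateUnit, h.eventually_norm⟩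

/-- Lemma 6.1: if `B` and `J` are closed *-subalgebras of a C*-algebra `C` with
`J = closed linear span of J·B`, and `x ∈ J` satisfies `x·B ⊆ B`, then `x ∈ B`. -/
theorem mem_of_mul_subset {C : Type*}
    [NormedRing C] [StarRing C] [CStarRing C] [NormedAlgebra ℂ C] [CompleteSpace C]
    [StarModule ℂ C]
    (B J : NonUnitalStarSubalgebra ℂ C)
    (hB : IsClosed (B : Set C)) (hJ : IsClosed (J : Set C))
    (hJB : (J : Set C)
      = closure (Submodule.span ℂ {x : C | ∃ j ∈ J, ∃ b ∈ B, x = j * b} : Set C))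
    (x : C) (hx : x ∈ J) (hxB : ∀ b ∈ B, x * b ∈ B) : x ∈ B := by
  let _ : CStarAlgebra C := {}
  obtain ⟨l, hl, hnorm⟩ := exists_isApproximateUnit_norm_le_one B
  have := hl.neBot
  have hx' : x ∈ closure (Submodule.span ℂ {x : C | ∃ j ∈ J, ∃ b ∈ B, x = j * b} : Set C) :=
    hJB ▸ hx
  have htendsto : Filter.Tendsto (fun e : B => x * (e : C)) l (nhds x) := by
    refine tendsto_mul_of_mem_closure (e := fun e : B => (e : C)) hnorm
      (fun y hy => tendsto_mul_of_mem_span ?_ hy) hx'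
    rintro _ ⟨j, -, b, hb, rfl⟩
    have hbe : Filter.Tendsto (fun e : B => b * (e : C)) l (nhds b) :=
      (continuous_subtype_val.tendsto _).comp (hl.tendsto_mul_left ⟨b, hb⟩)
    simpa only [mul_assoc] using hbe.const_mul j
  exact hB.mem_of_tendsto htendsto (Filter.Eventually.of_forall fun e => hxB e e.2)
end

section
/- For every invertible element λ in the center of A, every a ∈ A, and all n, m, p ∈ ℕ one has (i) λ^{-[m+p]} · α^m(ℒ^n(λ^[n+p] · a)) = λ^{-[m]} · α^m(ℒ^n(λ^[n] · a)), and (ii) α^m(ℒ^n(a · λ^[n+p])) · λ^{-[m+p]} = α^m(ℒ^n(a · λ^[n])) · λ^{-[m]}, where λ^{-[m]} denotes (λ⁻¹)^[m]. -/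
/-- `bpow f a n` is the element `a^[n] = a · f(a) · f²(a) ⋯ f^{n-1}(a)`, with `a^[0] = 1`. -/
def bpow {A : Type*} [Monoid A] (f : A → A) (a : A) : ℕ → A
  | 0 => 1
  | n + 1 => bpow f a n * f^[n] a

section BPow

variable {M F : Type*} [Monoid M] [FunLike F M M] [MonoidHomClass F M M] (f : F)

theorem bpow_add (a : M) (n p : ℕ) :
    bpow f a (n + p) = bpow f a n * f^[n] (bpow f a p) := by
  induction p with
  | zero => simp [bpow, iterate_map_one]
  | succ p ih =>
    rw [← add_assoc]
    simp only [bpow]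
    rw [ih, iterate_map_mul, mul_assoc, Function.iterate_add_apply]

theorem commute_bpow_iterate {c : M} (hc : ∀ x, Commute c x) (n : ℕ) (x : M) :
    Commute (bpow f c n) (f^[n] x) := by
  induction n generalizing x with
  | zero => exact Commute.one_left x
  | succ n ih =>
    refine Commute.mul_left (ih (f x)) ?_
    rw [Function.iterate_succ_apply, Commute, SemiconjBy, ← iterate_map_mul,
      ← iterate_map_mul, (hc (f x)).eq]

theorem bpow_mul_bpow_eq_one {c d : M} (hc : ∀ x, Commute c x) (hdc : d * c = 1) (n : ℕ) :
    bpow f d n * bpow f c n = 1 := by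
  induction n with
  | zero => exact mul_one 1
  | succ n ih =>
    calc bpow f d n * f^[n] d * (bpow f c n * f^[n] c)
        = bpow f d n * (f^[n] d * bpow f c n) * f^[n] c := by simp only [mul_assoc]
      _ = bpow f d n * bpow f c n * (f^[n] d * f^[n] c) := by
        rw [← (commute_bpow_iterate f hc n d).eq]
        simp only [mul_assoc]
      _ = 1 := by rw [ih, ← iterate_map_mul, hdc, iterate_map_one, one_mul]

end BPow

theorem iterate_transfer_mul_left {M : Type*} [Mul M] {f L : M → M}
    (hL : ∀ a b, L (f a * b) = a * L b)
    (n : ℕ) (a b : M) : L^[n] (f^[n] a * b) = a * L^[n] b := by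
  induction n generalizing b with
  | zero => rfl
  | succ n ih =>
    rw [Function.iterate_succ_apply, Function.iterate_succ_apply', hL, ih,
      ← Function.iterate_succ_apply]

theorem iterate_transfer_mul_right {M : Type*} [Mul M] {f L : M → M}
    (hL : ∀ a b, L (b * f a) = L b * a)
    (n : ℕ) (a b : M) : L^[n] (b * f^[n] a) = L^[n] b * a := by
  induction n generalizing b with
  | zero => rfl
  | succ n ih =>
    rw [Function.iterate_succ_apply, Function.iterate_succ_apply', hL, ih,
      ← Function.iterate_succ_apply]

/-- Proposition 7.6: for a central invertible `λ` (with inverse `λ'`) one has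
(i) `λ^{-[m+p]} α^m(ℒ^n(λ^[n+p] a)) = λ^{-[m]} α^m(ℒ^n(λ^[n] a))` and
(ii) `α^m(ℒ^n(a λ^[n+p])) λ^{-[m+p]} = α^m(ℒ^n(a λ^[n])) λ^{-[m]}`. -/
theorem bpow_cocycle_identities {A : Type*}
    [NormedRing A] [StarRing A] [CStarRing A] [NormedAlgebra ℂ A] [CompleteSpace A]
    [StarModule ℂ A] [PartialOrder A] [StarOrderedRing A]
    (α : A →⋆ₐ[ℂ] A) (hα : Function.Injective α)
    (E : A →ₗ[ℂ] A) (hEpos : ∀ x : A, 0 ≤ x → 0 ≤ E x)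
    (hErange : ∀ x : A, ∃ y : A, α y = E x)
    (hEfix : ∀ a : A, E (α a) = α a)
    (hEbimod : ∀ a b x : A, E (α a * x * α b) = α a * E x * α b)
    (L : A →ₗ[ℂ] A) (hL : ∀ a : A, α (L a) = E a)
    (lam lam' : A) (hc : lam ∈ Set.center A)
    (hinv1 : lam * lam' = 1) (hinv2 : lam' * lam = 1)
    (a : A) (n m p : ℕ) :
    (bpow ⇑α lam' (m + p) * (⇑α)^[m] ((⇑L)^[n] (bpow ⇑α lam (n + p) * a))
      = bpow ⇑α lam' m * (⇑α)^[m] ((⇑L)^[n] (bpow ⇑α lam n * a))) ∧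
    ((⇑α)^[m] ((⇑L)^[n] (a * bpow ⇑α lam (n + p))) * bpow ⇑α lam' (m + p)
      = (⇑α)^[m] ((⇑L)^[n] (a * bpow ⇑α lam n)) * bpow ⇑α lam' m) := by
  have hc1 : ∀ x, Commute lam x := fun x => (Set.mem_center_iff.mp hc).comm x
  have hc2 : ∀ x, Commute lam' x := fun x =>
    (hc1 x).units_inv_left (u := ⟨lam, lam', hinv1, hinv2⟩)
  have hLl : ∀ x y, L (α x * y) = x * L y := fun x y => hα <| by
    simpa [hL] using hEbimod x 1 y
  have hLr : ∀ x y, L (y * α x) = L y * x := fun x y => hα <| by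
    simpa [hL] using hEbimod 1 x y
  constructor
  · rw [bpow_add, bpow_add, (commute_bpow_iterate α hc1 n _).eq, mul_assoc (α^[n] _),
      iterate_transfer_mul_left hLl, iterate_map_mul, mul_assoc, ← mul_assoc (α^[m] _),
      ← iterate_map_mul, bpow_mul_bpow_eq_one α hc1 hinv2, iterate_map_one, one_mul]
  · rw [bpow_add, bpow_add, (commute_bpow_iterate α hc2 m _).eq, ← mul_assoc a,
      iterate_transfer_mul_right hLr, iterate_map_mul, mul_assoc (α^[m] _),
      ← mul_assoc (α^[m] (bpow α lam p)),
      ← iterate_map_mul, bpow_mul_bpow_eq_one α hc2 hinv1, iterate_map_one, one_mul]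
end

section
/- Let u_1, …, u_m ∈ A be a quasi-basis for E, i.e. a = Σ_{i=1}^m u_i E(u_i* a) for all a ∈ A. Then the element k := Σ_{j=1}^m ι(u_j) S S* ι(u_j*) of B satisfies k · ι(b) S = ι(b) S for every b ∈ A (so that the pair (1, k) is a redundancy). -/
/-- From the proof of Proposition 9.5: if `u_1, …, u_m` is a quasi-basis for `E`, then
`k = Σ_j ι(u_j) S S* ι(u_j*)` satisfies `k · ι(b) S = ι(b) S` for all `b` (so `(1, k)` is
a redundancy). -/
theorem quasi_basis_redundancy {A B : Type*}
    [NormedRing A] [StarRing A] [CStarRing A] [NormedAlgebra ℂ A] [CompleteSpace A]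
    [StarModule ℂ A] [PartialOrder A] [StarOrderedRing A]
    [NormedRing B] [StarRing B] [CStarRing B] [NormedAlgebra ℂ B] [CompleteSpace B]
    [StarModule ℂ B]
    (α : A →⋆ₐ[ℂ] A) (hα : Function.Injective α)
    (E : A →ₗ[ℂ] A) (hEpos : ∀ x : A, 0 ≤ x → 0 ≤ E x)
    (hErange : ∀ x : A, ∃ y : A, α y = E x)
    (hEfix : ∀ a : A, E (α a) = α a)
    (hEbimod : ∀ a b x : A, E (α a * x * α b) = α a * E x * α b)
    (L : A →ₗ[ℂ] A) (hL : ∀ a : A, α (L a) = E a)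
    (ι : A →⋆ₐ[ℂ] B) (S : B)
    (hS1 : star S * S = 1)
    (hS2 : ∀ a : A, S * ι a = ι (α a) * S)
    (hS3 : ∀ a : A, star S * ι a * S = ι (L a))
    (m : ℕ) (u : Fin m → A)
    (hqb : ∀ a : A, a = ∑ i, u i * E (star (u i) * a))
    (b : A) :
    (∑ j, ι (u j) * (S * star S) * ι (star (u j))) * (ι b * S) = ι b * S := by
  have term (j : Fin m) :
      ι (u j) * (S * star S) * ι (star (u j)) * (ι b * S) =
        ι (u j * E (star (u j) * b)) * S := by
    calc
      _ = ι (u j) * (S * (star S * ι (star (u j) * b) * S)) := by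
        simp only [map_mul, mul_assoc]
      _ = _ := by rw [hS3, hS2, hL, map_mul ι (u j), mul_assoc]
  rw [Finset.sum_mul, Finset.sum_congr rfl fun j _ => term j, ← Finset.sum_mul, ← map_sum,
    ← hqb b]
end

section
/- Let h be a self-adjoint element of the center of A with h ≥ c·1 for some real number c > 1, let β > 0 be real, and let p ≥ 1 be an integer. Let ψ be a state on B such that ψ(ι(a) S^p) = ψ(ι(a · h^{-β[p]}) S^p) for every a ∈ A, where h^{-β} is defined by continuous functional calculus and h^{-β[p]} = (h^{-β})^[p]. Then ψ(ι(a) S^p) = 0 for every a ∈ A. -/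
open scoped ComplexOrder

theorem norm_bpow_le {A : Type*} [CStarAlgebra A] [Nontrivial A] (f : A →⋆ₐ[ℂ] A) (a : A)
    (n : ℕ) : ‖bpow (⇑f) a n‖ ≤ ‖a‖ ^ n := by
  have iterate_le (m : ℕ) : ‖(⇑f)^[m] a‖ ≤ ‖a‖ := by
    induction m with
    | zero => simp
    | succ m ih =>
      rw [Function.iterate_succ_apply']
      exact (NonUnitalStarAlgHom.norm_apply_le f _).trans ih
  induction n with
  | zero => simp [bpow]
  | succ n ih =>
    rw [pow_succ]
    exact (norm_mul_le _ _).trans (by gcongr; exact iterate_le n)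

theorem norm_cfc_rpow_neg_lt_one {A : Type*} [CStarAlgebra A] [PartialOrder A] [StarOrderedRing A]
    {h : A} (hsa : IsSelfAdjoint h) {c : ℝ} (hc : 1 < c) (hch : algebraMap ℝ A c ≤ h)
    {β : ℝ} (hβ : 0 < β) : ‖cfc (fun t : ℝ => t ^ (-β)) h‖ < 1 := by
  have hc0 : 0 < c := one_pos.trans hc
  refine (norm_cfc_le (c := c ^ (-β)) (by positivity) fun t ht => ?_).trans_lt
    (Real.rpow_lt_one_of_one_lt_of_neg hc (neg_lt_zero.mpr hβ))
  have hct : c ≤ t := (algebraMap_le_iff_le_spectrum (a := h) hsa).mp hch t ht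
  rw [Real.norm_of_nonneg (Real.rpow_nonneg (hc0.le.trans hct) _)]
  exact Real.rpow_le_rpow_of_nonpos hc0 hct (neg_nonpos.mpr hβ.le)

theorem norm_bpow_lt_one {A : Type*} [CStarAlgebra A] (f : A →⋆ₐ[ℂ] A) {a : A} (ha : ‖a‖ < 1)
    {n : ℕ} (hn : n ≠ 0) : ‖bpow (⇑f) a n‖ < 1 := by
  nontriviality A
  exact (norm_bpow_le f a n).trans_lt (pow_lt_one₀ (norm_nonneg a) ha hn)

/-- The key step of Proposition 9.4: if `h ≥ c·1` with `c > 1`, `β > 0`, `p ≥ 1`, and a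
state `ψ` satisfies `ψ(ι(a) S^p) = ψ(ι(a h^{-β[p]}) S^p)` for all `a` (an instance of the
KMS condition), then `ψ(ι(a) S^p) = 0` for all `a`. Here `h^{-β}` is defined by the
continuous functional calculus. -/
theorem kms_state_vanishes {A B : Type*}
    [CStarAlgebra A] [PartialOrder A] [StarOrderedRing A]
    [CStarAlgebra B] [PartialOrder B] [StarOrderedRing B]
    (α : A →⋆ₐ[ℂ] A) (hα : Function.Injective α)
    (E : A →ₗ[ℂ] A) (hEpos : ∀ x : A, 0 ≤ x → 0 ≤ E x)
    (hErange : ∀ x : A, ∃ y : A, α y = E x)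
    (hEfix : ∀ a : A, E (α a) = α a)
    (hEbimod : ∀ a b x : A, E (α a * x * α b) = α a * E x * α b)
    (L : A →ₗ[ℂ] A) (hL : ∀ a : A, α (L a) = E a)
    (ι : A →⋆ₐ[ℂ] B) (S : B)
    (hS1 : star S * S = 1)
    (hS2 : ∀ a : A, S * ι a = ι (α a) * S)
    (hS3 : ∀ a : A, star S * ι a * S = ι (L a))
    (h : A) (hsa : IsSelfAdjoint h) (hcen : h ∈ Set.center A)
    (c : ℝ) (hc : 1 < c) (hch : (c : ℂ) • (1 : A) ≤ h)
    (β : ℝ) (hβ : 0 < β) (p : ℕ) (hp : 1 ≤ p)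
    (ψ : B →L[ℂ] ℂ) (hψ1 : ψ 1 = 1) (hψpos : ∀ x : B, 0 ≤ x → 0 ≤ ψ x)
    (hkms : ∀ a : A, ψ (ι a * S ^ p)
      = ψ (ι (a * bpow ⇑α (cfc (fun t : ℝ => t ^ (-β)) h) p) * S ^ p))
    (a : A) :
    ψ (ι a * S ^ p) = 0 := by
  set x := bpow ⇑α (cfc (fun t : ℝ => t ^ (-β)) h) p
  have hx : ‖x‖ < 1 := by
    refine norm_bpow_lt_one α (norm_cfc_rpow_neg_lt_one hsa hc ?_ hβ) (by omega)
    rwa [Algebra.algebraMap_eq_smul_one, ← Complex.coe_smul]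
  obtain ⟨u, hu⟩ := isUnit_one_sub_of_norm_lt_one hx
  have key (b : A) : ψ (ι (b * (1 - x)) * S ^ p) = 0 := by
    rw [mul_sub, mul_one, map_sub, sub_mul, map_sub, ← hkms, sub_self]
  simpa [← hu] using key (a * ↑u⁻¹)
end

section
/- Let X be a nonempty set and θ : X → X a surjective map all of whose fibers θ⁻¹({x}) are finite. Let v_1, …, v_m : X → ℝ satisfy v_i ≥ 0, Σ_{i=1}^m v_i(x) = 1 for all x ∈ X, and for each i the restriction of θ to { x ∈ X : v_i(x) ≠ 0 } is injective. Define N(x) = card(θ⁻¹({x})), μ = N ∘ θ, u_i = (μ · v_i)^{1/2} (pointwise square root), and for a function f : X → ℂ define E(f)(x) = μ(x)⁻¹ · Σ_{t : θ(t) = θ(x)} f(t). Then for every f : X → ℂ and every x ∈ X one has Σ_{i=1}^m u_i(x) · E(u_i · f)(x) = f(x) (so that {u_1, …, u_m} is a quasi-basis for E), and Σ_{i=1}^m u_i(x)² = μ(x) (so that ind(E) = μ). -/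
/-- Section 11: for the conditional expectation `E` averaging over the fibers of a
surjective finite-to-one map `θ`, the functions `u_i = (μ v_i)^{1/2}` form a quasi-basis
for `E` and `ind(E) = Σ_i u_i² = μ`. -/
theorem quasi_basis_for_fiber_expectation {X : Type*} [Nonempty X]
    (θ : X → X) (hsurj : Function.Surjective θ)
    (hfin : ∀ x : X, (θ ⁻¹' {x}).Finite)
    (m : ℕ) (v : Fin m → X → ℝ)
    (hv0 : ∀ (i : Fin m) (x : X), 0 ≤ v i x)
    (hv1 : ∀ x : X, ∑ i, v i x = 1)
    (hvinj : ∀ i : Fin m, Set.InjOn θ {x : X | v i x ≠ 0})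
    (N : X → ℕ) (hN : ∀ x : X, N x = (hfin x).toFinset.card)
    (μ : X → ℕ) (hμ : ∀ x : X, μ x = N (θ x))
    (u : Fin m → X → ℝ) (hu : ∀ (i : Fin m) (x : X), u i x = Real.sqrt (μ x * v i x))
    (E : (X → ℂ) → X → ℂ)
    (hE : ∀ (f : X → ℂ) (x : X),
      E f x = (μ x : ℂ)⁻¹ * ∑ t ∈ (hfin (θ x)).toFinset, f t)
    (f : X → ℂ) (x : X) :
    (∑ i, (u i x : ℂ) * E (fun t => (u i t : ℂ) * f t) x = f x) ∧
    (∑ i, (u i x) ^ 2 = (μ x : ℝ)) := by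
  have hμ0 : (μ x : ℂ) ≠ 0 := by
    rw [hμ, hN, Nat.cast_ne_zero]
    exact Finset.card_ne_zero_of_mem (a := x) (by simp)
  have husq (i : Fin m) : u i x ^ 2 = μ x * v i x := by
    rw [hu, Real.sq_sqrt (mul_nonneg (Nat.cast_nonneg _) (hv0 i x))]
  have hterm (i : Fin m) :
      (u i x : ℂ) * E (fun t => (u i t : ℂ) * f t) x = (v i x : ℂ) * f x := by
    by_cases hvx : v i x = 0
    · simp [hu, hvx]
    · have hsum : ∑ t ∈ (hfin (θ x)).toFinset, (u i t : ℂ) * f t = (u i x : ℂ) * f x := by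
        refine Finset.sum_eq_single_of_mem x (by simp) fun t ht htx => ?_
        have hvt : v i t = 0 := by
          by_contra hvt
          exact htx (hvinj i hvt hvx (by simpa using ht))
        simp [hu, hvt]
      have husq' : (u i x : ℂ) ^ 2 = μ x * v i x := by exact_mod_cast husq i
      rw [hE, hsum]
      calc (u i x : ℂ) * ((μ x : ℂ)⁻¹ * (u i x * f x))
          = (μ x : ℂ)⁻¹ * (u i x : ℂ) ^ 2 * f x := by ring
        _ = (v i x : ℂ) * f x := by rw [husq', inv_mul_cancel_left₀ hμ0]
  constructor
  · have hv1' : ∑ i, (v i x : ℂ) = 1 := by exact_mod_cast hv1 x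
    simp_rw [hterm, ← Finset.sum_mul, hv1', one_mul]
  · simp_rw [husq, ← Finset.mul_sum, hv1, mul_one]
end
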